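/- The line k·ω_{0,0} is the unique T-stable line in V₊: if v ∈ V₊ is nonzero and for every t ∈ F* there exists c(t) ∈ k with h(t)·v = c(t)·v, then v ∈ k·ω_{0,0}. -/

import Mathlib

noncomputable section

open scoped TensorProduct

namespace SL2X

variable (p : ℕ) [Fact p.Prime]

/-- The algebraic closure of the prime field `𝔽_p`. -/
abbrev F : Type := AlgebraicClosure (ZMod p)

/-- `G = SL₂(F)`. -/
abbrev G : Type := Matrix.SpecialLinearGroup (Fin 2) (F p)

/-- The unipotent element `ε(x) = [[1,x],[0,1]]`. -/
def eps (x : F p) : G p :=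
  ⟨!![1, x; 0, 1], by simp [Matrix.det_fin_two_of]⟩

/-- The torus element `h(t) = diag(t, t⁻¹)`. -/
def h (t : (F p)ˣ) : G p :=
  ⟨!![(t : F p), 0; 0, ((t⁻¹ : (F p)ˣ) : F p)], by simp [Matrix.det_fin_two_of]⟩

/-- The Weyl element `s = [[0,1],[-1,0]]`. -/
def sG : G p :=
  ⟨!![0, 1; -1, 0], by simp [Matrix.det_fin_two_of]⟩

/-- The Borel subgroup `B` of upper triangular matrices in `G`. -/
def B : Subgroup (G p) where
  carrier := {g | (g : Matrix (Fin 2) (Fin 2) (F p)) 1 0 = 0}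
  one_mem' := by simp [Matrix.one_apply]
  mul_mem' := by
    intro a b ha hb
    simp only [Set.mem_setOf_eq] at *
    simp [Matrix.mul_apply, Fin.sum_univ_two, ha, hb]
  inv_mem' := by
    intro a ha
    simp only [Set.mem_setOf_eq] at *
    simp [Matrix.SpecialLinearGroup.coe_inv, Matrix.adjugate_fin_two, ha]

/-- The diagonal part of an element of `B`, as a unit of `F`. -/
def Bdiag (b : B p) : (F p)ˣ where
  val := ((b : G p) : Matrix (Fin 2) (Fin 2) (F p)) 0 0
  inv := ((b : G p) : Matrix (Fin 2) (Fin 2) (F p)) 1 1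
  val_inv := by
    have hdet : ((b : G p) : Matrix (Fin 2) (Fin 2) (F p)).det = 1 := (b : G p).2
    have h10 : ((b : G p) : Matrix (Fin 2) (Fin 2) (F p)) 1 0 = 0 := b.2
    rw [Matrix.det_fin_two, h10, mul_zero, sub_zero] at hdet
    exact hdet
  inv_val := by
    have hdet : ((b : G p) : Matrix (Fin 2) (Fin 2) (F p)).det = 1 := (b : G p).2
    have h10 : ((b : G p) : Matrix (Fin 2) (Fin 2) (F p)) 1 0 = 0 := b.2
    rw [Matrix.det_fin_two, h10, mul_zero, sub_zero] at hdet
    rw [mul_comm]; exact hdet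

variable (k : Type) [Field k] [IsAlgClosed k] [CharZero k]

/-- The group algebra `kG`. -/
abbrev kG : Type := MonoidAlgebra k (G p)

/-- The canonical image of a group element in the group algebra. -/
def γ (g : G p) : kG p k := MonoidAlgebra.of k (G p) g

/-- The submodule of relations defining the induced module
`M(θ) = kG ⊗_{kB} k_θ`, where the character `θ` of `T ≅ Fˣ` is extended to `B`
by letting `U` act trivially. -/
def Nmod (θ : (F p)ˣ →* kˣ) : Submodule (kG p k) (kG p k) :=
  Submodule.span (kG p k)
    {y | ∃ b : B p, y = γ p k (b : G p) - ((θ (Bdiag p b) : k)) • (1 : kG p k)}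

/-- The induced module `M(θ) = kG ⊗_{kB} k_θ`, realized as `kG / N(θ)` where
`N(θ)` is the left submodule generated by the elements `b - θ(b)·1`, `b ∈ B`. -/
def Mmod (θ : (F p)ˣ →* kˣ) : Type := kG p k ⧸ Nmod p k θ

instance (θ : (F p)ˣ →* kˣ) : AddCommGroup (Mmod p k θ) :=
  inferInstanceAs (AddCommGroup (kG p k ⧸ Nmod p k θ))
instance (θ : (F p)ˣ →* kˣ) : Module (kG p k) (Mmod p k θ) :=
  inferInstanceAs (Module (kG p k) (kG p k ⧸ Nmod p k θ))
instance (θ : (F p)ˣ →* kˣ) : Module k (Mmod p k θ) :=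
  inferInstanceAs (Module k (kG p k ⧸ Nmod p k θ))
instance (θ : (F p)ˣ →* kˣ) : IsScalarTower k (kG p k) (Mmod p k θ) :=
  inferInstanceAs (IsScalarTower k (kG p k) (kG p k ⧸ Nmod p k θ))

/-- The canonical generator `1_θ ∈ M(θ)`. -/
def oneθ (θ : (F p)ˣ →* kˣ) : Mmod p k θ :=
  Submodule.Quotient.mk (1 : kG p k)

/-- `η = (1 - s)·1_tr ∈ M(tr)`. -/
def eta : Mmod p k 1 :=
  Submodule.Quotient.mk ((1 : kG p k) - γ p k (sG p))

/-- The Steinberg module `St = kG·η ⊆ M(tr)`. -/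
def St : Submodule (kG p k) (Mmod p k 1) :=
  Submodule.span (kG p k) {eta p k}

/-- `ε(x)·η` as an element of `St`. -/
def E (x : F p) : ↥(St p k) :=
  ⟨γ p k (eps p x) • eta p k,
    Submodule.smul_mem _ _ (Submodule.mem_span_singleton_self _)⟩

/-- The action of a group element on `St`, as a `k`-linear map. -/
def gSt (g : G p) : ↥(St p k) →ₗ[k] ↥(St p k) where
  toFun v := ⟨γ p k g • (v : Mmod p k 1), Submodule.smul_mem _ _ v.2⟩
  map_add' := by intro a b; apply Subtype.ext; simp [smul_add]
  map_smul' := by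
    intro c v; apply Subtype.ext
    simp [smul_comm (γ p k g) c]

/-- `St ⊗_k St`. -/
abbrev StT : Type := ↥(St p k) ⊗[k] ↥(St p k)

/-- The diagonal action of a group element on `St ⊗_k St`. -/
def gTT (g : G p) : StT p k →ₗ[k] StT p k :=
  TensorProduct.map (gSt p k g) (gSt p k g)

/-- `ω_{x,y} = (ε(x)η ⊗ ε(y)η + ε(y)η ⊗ ε(x)η)/2`. -/
def ω (x y : F p) : StT p k :=
  (2 : k)⁻¹ • (E p k x ⊗ₜ[k] E p k y + E p k y ⊗ₜ[k] E p k x)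

/-- `ρ_{x,y} = (ε(x)η ⊗ ε(y)η − ε(y)η ⊗ ε(x)η)/2`. -/
def ρ (x y : F p) : StT p k :=
  (2 : k)⁻¹ • (E p k x ⊗ₜ[k] E p k y - E p k y ⊗ₜ[k] E p k x)

/-- `V₊`, the span of the `ω_{x,y}`. -/
def Vplus : Submodule k (StT p k) :=
  Submodule.span k {v | ∃ x y : F p, v = ω p k x y}

/-- `V₋`, the span of the `ρ_{x,y}` for `x ≠ y`. -/
def Vminus : Submodule k (StT p k) :=
  Submodule.span k {v | ∃ x y : F p, x ≠ y ∧ v = ρ p k x y}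


/-- The matrix entries of an element of `G`. -/
def entry (g : G p) (i j : Fin 2) : F p := (g : Matrix (Fin 2) (Fin 2) (F p)) i j

theorem entry_mul (g g' : G p) (i j : Fin 2) :
    entry p (g * g') i j = entry p g i 0 * entry p g' 0 j + entry p g i 1 * entry p g' 1 j := by
  simp [entry, Matrix.SpecialLinearGroup.coe_mul, Matrix.mul_apply, Fin.sum_univ_two]

theorem ext_entry {g g' : G p} (hg : ∀ i j, entry p g i j = entry p g' i j) : g = g' :=
  Matrix.SpecialLinearGroup.ext g g' hg

theorem entry_eps (x : F p) (i j : Fin 2) : entry p (eps p x) i j = !![1, x; 0, 1] i j := rfl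

theorem entry_h (t : (F p)ˣ) (i j : Fin 2) :
    entry p (h p t) i j = !![(t : F p), 0; 0, ((t⁻¹ : (F p)ˣ) : F p)] i j := rfl

theorem entry_sG (i j : Fin 2) : entry p (sG p) i j = !![0, 1; -1, 0] i j := rfl

open Classical in
/-- The `k`-linear map `kG → (F →₀ k)` sending `g` to `-δ_{a/c}` when the first column of `g` is
`(a, c)` with `c ≠ 0`, and to `0` when `g ∈ B`. -/
def bigCellCoord : kG p k →ₗ[k] (F p →₀ k) :=
  Finsupp.linearCombination k (fun g : G p =>
    if entry p g 1 0 = 0 then (0 : F p →₀ k) else -Finsupp.single (entry p g 0 0 / entry p g 1 0) 1) ∘ₗ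
  (MonoidAlgebra.coeffLinearEquiv k).toLinearMap

open Classical in
theorem bigCellCoord_single (g : G p) (c : k) :
    bigCellCoord p k (MonoidAlgebra.single g c) =
      c • (if entry p g 1 0 = 0 then (0 : F p →₀ k)
        else -Finsupp.single (entry p g 0 0 / entry p g 1 0) 1) := by
  simp [bigCellCoord]

theorem bigCellCoord_mul_of_mem_B (g : G p) (b : B p) (c : k) :
    bigCellCoord p k (MonoidAlgebra.single (g * b) c) =
      bigCellCoord p k (MonoidAlgebra.single g c) := by
  have h10 : entry p b 1 0 = 0 := b.2
  have h00 : entry p b 0 0 ≠ 0 := (Bdiag p b).ne_zero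
  have e1 : entry p (g * (b : G p)) 1 0 = entry p g 1 0 * entry p b 0 0 := by
    simp [entry_mul, h10]
  have e0 : entry p (g * (b : G p)) 0 0 = entry p g 0 0 * entry p b 0 0 := by
    simp [entry_mul, h10]
  rw [bigCellCoord_single, bigCellCoord_single, e1, e0]
  by_cases hc : entry p g 1 0 = 0 <;> simp [hc, h00, mul_div_mul_right]

theorem bigCellCoord_eq_zero_of_mem {y : kG p k} (hy : y ∈ Nmod p k 1) :
    bigCellCoord p k y = 0 := by
  refine Submodule.closure_induction (p := fun y _ => bigCellCoord p k y = 0)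
    (map_zero _) (fun a b _ _ ha hb => by rw [map_add, ha, hb, add_zero]) ?_ hy
  rintro r _ ⟨b, rfl⟩
  induction r using MonoidAlgebra.induction_linear with
  | zero => simp
  | add r₁ r₂ h₁ h₂ => rw [add_smul, map_add, h₁, h₂, add_zero]
  | single g c =>
    simp [γ, mul_sub, MonoidAlgebra.single_mul_single, bigCellCoord_mul_of_mem_B]

/-- `bigCellCoord`, descended to `M(tr)`. -/
def Mcoord : Mmod p k 1 →ₗ[k] (F p →₀ k) :=
  (((Nmod p k 1).restrictScalars k).liftQ (bigCellCoord p k)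
    (fun _ hy => bigCellCoord_eq_zero_of_mem p k hy)) ∘ₗ
  (Submodule.Quotient.restrictScalarsEquiv k (Nmod p k 1)).symm.toLinearMap

/-- `Mcoord` restricted to `St`: the coordinates with respect to the basis `ε(x)η`. -/
def StCoord : ↥(St p k) →ₗ[k] (F p →₀ k) :=
  Mcoord p k ∘ₗ ((St p k).restrictScalars k).subtype

theorem StCoord_E (x : F p) : StCoord p k (E p k x) = Finsupp.single x 1 := by
  have : StCoord p k (E p k x) =
      bigCellCoord p k (γ p k (eps p x) * (1 - γ p k (sG p))) := rfl
  rw [this, mul_sub, mul_one, map_sub]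
  simp only [γ, ← map_mul]
  simp [bigCellCoord_single, entry_mul, entry_eps, entry_sG]

theorem γ_mul (g g' : G p) : γ p k (g * g') = γ p k g * γ p k g' := map_mul _ _ _

theorem γ_smul_oneθ_of_mem_B (b : B p) :
    γ p k (b : G p) • oneθ p k 1 = oneθ p k 1 := by
  refine (Submodule.Quotient.eq (Nmod p k 1)).2 ?_
  refine Submodule.subset_span ⟨b, ?_⟩
  simp

theorem h_mem_B (t : (F p)ˣ) : h p t ∈ B p := by
  change entry p (h p t) 1 0 = 0
  simp [entry_h]

theorem eta_eq : eta p k = oneθ p k 1 - γ p k (sG p) • oneθ p k 1 := by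
  have : γ p k (sG p) • oneθ p k 1 =
    (Submodule.Quotient.mk (γ p k (sG p) * 1) : kG p k ⧸ Nmod p k 1) := rfl
  rw [this, mul_one]
  rfl

theorem h_smul_eta (t : (F p)ˣ) : γ p k (h p t) • eta p k = eta p k := by
  have hs : h p t * sG p = sG p * h p t⁻¹ := by
    refine ext_entry p fun i j => ?_
    fin_cases i <;> fin_cases j <;>
      simp [entry_mul, entry_h, entry_sG]
  rw [eta_eq, smul_sub, γ_smul_oneθ_of_mem_B p k ⟨h p t, h_mem_B p t⟩, smul_smul, ← γ_mul, hs,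
    γ_mul, mul_smul, γ_smul_oneθ_of_mem_B p k ⟨h p t⁻¹, h_mem_B p t⁻¹⟩]

theorem gSt_h_E (t : (F p)ˣ) (x : F p) :
    gSt p k (h p t) (E p k x) = E p k ((t : F p) ^ 2 * x) := by
  have hs : h p t * eps p x = eps p ((t : F p) ^ 2 * x) * h p t := by
    refine ext_entry p fun i j => ?_
    fin_cases i <;> fin_cases j <;>
      simp [entry_mul, entry_h, entry_eps]
    field_simp
  apply Subtype.ext
  change γ p k (h p t) • γ p k (eps p x) • eta p k = γ p k (eps p _) • eta p k
  rw [smul_smul, ← γ_mul, hs, γ_mul, mul_smul, h_smul_eta]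

/-- The linear combination of the `ε(x)η ⊗ ε(y)η` with prescribed coefficients. -/
def ofCoeffs : (F p × F p →₀ k) →ₗ[k] StT p k :=
  Finsupp.linearCombination k fun z => E p k z.1 ⊗ₜ[k] E p k z.2

theorem ofCoeffs_injective : Function.Injective (ofCoeffs p k) := by
  let Ψ : StT p k →ₗ[k] (F p × F p →₀ k) :=
    (finsuppTensorFinsupp' k (F p) (F p)).toLinearMap ∘ₗ
      TensorProduct.map (StCoord p k) (StCoord p k)
  have hΨ : Ψ ∘ₗ ofCoeffs p k = LinearMap.id := by
    ext z : 2
    simp [Ψ, ofCoeffs, StCoord_E]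
  exact Function.LeftInverse.injective (g := Ψ) fun f => LinearMap.congr_fun hΨ f

/-- Scaling by `t²` on pairs. -/
def scalePair (t : (F p)ˣ) (z : F p × F p) : F p × F p :=
  ((t : F p) ^ 2 * z.1, (t : F p) ^ 2 * z.2)

theorem scalePair_injective (t : (F p)ˣ) : Function.Injective (scalePair p t) := by
  rintro ⟨a, b⟩ ⟨a', b'⟩ hab
  simpa [scalePair] using hab

theorem gTT_h_ofCoeffs (t : (F p)ˣ) (f : F p × F p →₀ k) :
    gTT p k (h p t) (ofCoeffs p k f) = ofCoeffs p k (f.mapDomain (scalePair p t)) := by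
  induction f using Finsupp.induction_linear with
  | zero => simp
  | add f g hf hg => rw [map_add, map_add, hf, hg, Finsupp.mapDomain_add, map_add]
  | single z c =>
    simp [ofCoeffs, Finsupp.mapDomain_single, gTT, gSt_h_E, scalePair]

theorem exists_ofCoeffs_eq {v : StT p k} (hv : v ∈ Vplus p k) : ∃ f, ofCoeffs p k f = v := by
  have hle : Vplus p k ≤ LinearMap.range (ofCoeffs p k) := by
    refine Submodule.span_le.2 ?_
    rintro _ ⟨x, y, rfl⟩
    refine ⟨(2 : k)⁻¹ • (Finsupp.single (x, y) 1 + Finsupp.single (y, x) 1), ?_⟩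
    simp [ofCoeffs, ω]
  exact hle hv

/-- A finitely supported function on `F × F` that is semi-invariant under all the scalings by
squares is supported at the origin. -/
theorem eq_zero_of_scalePair_semiinvariant {f : F p × F p →₀ k}
    (hf : ∀ t, ∃ c : k, f.mapDomain (scalePair p t) = c • f)
    {z : F p × F p} (hz : z ≠ 0) : f z = 0 := by
  by_contra hfz
  have hmem : ∀ t : (F p)ˣ, scalePair p t z ∈ f.support := by
    intro t
    obtain ⟨c, hc⟩ := hf t
    have hc' := DFunLike.congr_fun hc (scalePair p t z)
    rw [Finsupp.mapDomain_apply (scalePair_injective p t), Finsupp.smul_apply] at hc'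
    rw [Finsupp.mem_support_iff]
    intro h0
    rw [h0, smul_zero] at hc'
    exact hfz hc'
  have hinf : Set.Infinite {a : F p | a ≠ 0} := (Set.finite_singleton (0 : F p)).infinite_compl
  refine hinf ?_
  have hinj : Function.Injective fun a : F p => (a * z.1, a * z.2) := by
    intro a b hab
    simp only [Prod.mk.injEq, mul_eq_mul_right_iff] at hab
    by_contra hne
    exact hz (Prod.ext (hab.1.resolve_left hne) (hab.2.resolve_left hne))
  refine (f.support.finite_toSet.preimage hinj.injOn).subset ?_
  intro a ha
  obtain ⟨r, hr⟩ := IsAlgClosed.exists_pow_nat_eq a (n := 2) two_pos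
  have hr0 : r ≠ 0 := by
    rintro rfl
    exact ha (by simpa using hr.symm)
  have := hmem (Units.mk0 r hr0)
  simpa [scalePair, hr] using this

/-- `k·ω_{0,0}` is the unique `T`-stable line in `V₊`. -/
theorem stmt9 (hp2 : p ≠ 2) (v : StT p k) (hv : v ∈ Vplus p k) (hv0 : v ≠ 0)
    (hT : ∀ t : (F p)ˣ, ∃ c : k, gTT p k (h p t) v = c • v) :
    ∃ c : k, v = c • ω p k 0 0 := by
  obtain ⟨f, rfl⟩ := exists_ofCoeffs_eq p k hv
  have hf : ∀ t, ∃ c : k, f.mapDomain (scalePair p t) = c • f := by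
    intro t
    obtain ⟨c, hc⟩ := hT t
    refine ⟨c, ofCoeffs_injective p k ?_⟩
    rw [← gTT_h_ofCoeffs, hc, map_smul]
  have hsingle : f = Finsupp.single 0 (f 0) := by
    ext z
    rcases eq_or_ne z 0 with rfl | hz
    · simp
    · rw [eq_zero_of_scalePair_semiinvariant p k hf hz, Finsupp.single_eq_of_ne hz]
  refine ⟨f 0, ?_⟩
  rw [hsingle]
  simp [ofCoeffs, ω, ← two_smul k (E p k 0 ⊗ₜ[k] E p k 0)]

end SL2X
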